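/- For every natural number M there exists a finite connected 3-regular simple graph Λ with |V(Λ)| ≥ M such that Aut(Λ) acts transitively on the 2-arcs of Λ and 72 · dim_{F_2} E_1(Λ) ≥ |V(Λ)|. -/

import Mathlib

/-- A permutation `g` of the vertex set is an automorphism of the graph `Λ`. -/
def IsGraphAut {V : Type*} (Λ : SimpleGraph V) (g : Equiv.Perm V) : Prop :=
  ∀ u v : V, Λ.Adj (g u) (g v) ↔ Λ.Adj u v

/-- The full automorphism group of `Λ` acts transitively on the 2-arcs of `Λ`. -/
def TwoArcTransitiveAut {V : Type*} (Λ : SimpleGraph V) : Prop :=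
  ∀ u v w u' v' w' : V, Λ.Adj u v → Λ.Adj v w → u ≠ w →
    Λ.Adj u' v' → Λ.Adj v' w' → u' ≠ w' →
      ∃ g : Equiv.Perm V, IsGraphAut Λ g ∧ g u = u' ∧ g v = v' ∧ g w = w'

open scoped Classical in
/-- The 1-eigenspace of the adjacency matrix of `Λ` over `F₂`. -/
noncomputable def eigOne {V : Type*} [Fintype V] (Λ : SimpleGraph V) :
    Submodule (ZMod 2) (V → ZMod 2) :=
  LinearMap.ker (Matrix.toLin' (Λ.adjMatrix (ZMod 2)) - LinearMap.id)

/-! The graphs are the `(ℤ/n)⁴`-covers of the Möbius–Kantor graph for a suitable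
symmetric voltage assignment (coming from the Hurwitz quaternions). -/

namespace MK

/-- Quadruples. -/
abbrev Q (R : Type) := R × R × R × R

def tgt : Fin 16 → Fin 3 → Fin 16 :=
  ![![1, 2, 3],
    ![4, 5, 0],
    ![0, 6, 7],
    ![0, 8, 9],
    ![1, 10, 11],
    ![1, 12, 13],
    ![11, 2, 14],
    ![10, 13, 2],
    ![13, 3, 14],
    ![12, 11, 3],
    ![7, 4, 15],
    ![6, 9, 4],
    ![9, 5, 15],
    ![8, 7, 5],
    ![15, 6, 8],
    ![14, 12, 10]]

def vol : Fin 16 → Fin 3 → Q ℤ :=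
  ![![(0, 0, 0, 0), (0, 0, 0, 0), (0, 0, 0, 0)],
    ![(0, 0, 0, 0), (0, 0, 0, 0), (0, 0, 0, 0)],
    ![(0, 0, 0, 0), (0, 0, 0, 0), (0, 0, 0, 0)],
    ![(0, 0, 0, 0), (0, 0, 0, 0), (0, 0, 0, 0)],
    ![(0, 0, 0, 0), (0, 0, 0, 0), (0, 0, 0, 0)],
    ![(0, 0, 0, 0), (0, 0, 0, 0), (0, 0, 0, 0)],
    ![(-1, 0, 1, 0), (0, 0, 0, 0), (0, 0, 0, 0)],
    ![(0, 0, 1, 0), (0, -1, 1, 0), (0, 0, 0, 0)],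
    ![(-1, -1, 1, 1), (0, 0, 0, 0), (0, -1, 0, 1)],
    ![(0, -1, 1, 1), (-1, 0, 1, 1), (0, 0, 0, 0)],
    ![(0, 0, -1, 0), (0, 0, 0, 0), (0, 0, 0, 0)],
    ![(1, 0, -1, 0), (1, 0, -1, -1), (0, 0, 0, 0)],
    ![(0, 1, -1, -1), (0, 0, 0, 0), (0, 1, 0, -1)],
    ![(1, 1, -1, -1), (0, 1, -1, 0), (0, 0, 0, 0)],
    ![(0, 1, 0, -1), (0, 0, 0, 0), (0, 1, 0, -1)],
    ![(0, -1, 0, 1), (0, -1, 0, 1), (0, 0, 0, 0)]]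

def supp : Fin 16 → List (Q ℤ) :=
  ![[(0, 0, 0, 0), (1, 0, 0, 0), (0, 1, 0, 0), (-1, 1, 0, 0)],
    [(0, 0, 0, 0), (-1, 0, 0, 1), (0, 0, 0, 1), (1, 0, 0, 0)],
    [(0, 0, 0, 0), (-1, 0, 0, 1), (0, 0, 0, 1), (1, 0, -1, 0), (0, 1, -1, 0), (0, 1, 0, 0)],
    [(0, 0, 0, 0), (1, 0, -1, 0), (0, 1, -1, 0), (-1, 1, 0, 0)],
    [(0, 0, 0, 0), (-1, 0, 1, 1), (0, 0, 1, 0), (-1, 1, 0, 0), (0, 1, 0, 0), (0, 0, 0, 1)],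
    [(0, 0, 0, 0), (-1, 0, 1, 1), (0, 0, 1, 0), (-1, 0, 0, 1)],
    [(0, 0, 0, 1), (1, 0, -1, 0), (1, 0, 0, 0), (0, 0, -1, 1)],
    [(-1, 0, 0, 1), (0, 1, -1, 0), (-1, 1, 0, 0), (0, 0, -1, 1)],
    [(0, 0, 0, 0), (0, 1, 0, -1), (1, 1, -1, -1), (1, 0, 0, 0), (0, 1, 0, 0), (0, 1, -1, 0)],
    [(0, 0, 0, 0), (0, 1, 0, -1), (1, 1, -1, -1), (1, 0, -1, 0)],
    [(0, 0, 1, 0), (0, 1, 0, 0), (-1, 1, 1, 0), (1, 0, 0, 0)],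
    [(-1, 0, 1, 1), (-1, 1, 0, 0), (-1, 0, 0, 1), (-1, 1, 1, 0)],
    [(0, -1, 1, 1), (0, 0, 0, 0), (0, -1, 0, 1), (-1, 0, 1, 1), (0, 0, 0, 1), (1, 0, 0, 0)],
    [(0, 0, 0, 0), (0, -1, 1, 1), (0, -1, 0, 1), (0, 0, 1, 0)],
    [(0, 0, 0, 0), (0, 0, 0, 1), (-1, 0, 0, 1), (1, 0, 0, 0)],
    [(0, 0, 0, 0), (0, 1, 0, 0), (-1, 1, 0, 0), (1, 0, 0, 0)]]

def piRot : Fin 16 → Fin 16 := ![0, 2, 3, 1, 6, 7, 9, 8, 5, 4, 14, 11, 10, 13, 12, 15]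

def matRot : Q (Q ℤ) := ((0, 1, 0, 1), (-1, -1, -1, 0), (0, 0, 0, -1), (0, 0, 1, -1))

def invRot : Q (Q ℤ) := ((-1, -1, 0, -1), (1, 0, 1, 0), (0, 0, -1, 1), (0, 0, -1, 0))

def shiftRot : Fin 16 → Q ℤ :=
  ![(0, 0, 0, 0), (0, 0, 0, 0), (0, 0, 0, 0), (0, 0, 0, 0), (0, 0, 0, 0), (0, 0, 0, 0), (0, 0, 0, 0), (0, 0, 0, 0),
    (0, 0, 0, 0), (0, 0, 0, 0), (0, 0, 0, 0), (-1, 0, 1, 0), (0, 0, 1, 0), (0, -1, 1, 0), (0, -1, 1, 1), (0, 1, 0, -1)]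

def piRef : Fin 16 → Fin 16 := ![0, 1, 3, 2, 5, 4, 8, 9, 6, 7, 12, 13, 10, 11, 14, 15]

def matRef : Q (Q ℤ) := ((1, 1, 0, 1), (0, -1, -1, 0), (0, 0, 1, 0), (0, 0, 1, -1))

def invRef : Q (Q ℤ) := ((1, 1, 0, 1), (0, -1, -1, 0), (0, 0, 1, 0), (0, 0, 1, -1))

def shiftRef : Fin 16 → Q ℤ :=
  ![(0, 0, 0, 0), (0, 0, 0, 0), (0, 0, 0, 0), (0, 0, 0, 0), (0, 0, 0, 0), (0, 0, 0, 0), (0, 0, 0, 0), (0, 0, 0, 0),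
    (0, 0, 0, 0), (0, 0, 0, 0), (0, 0, 0, 0), (0, 0, 0, 0), (0, 0, 0, 0), (0, 0, 0, 0), (0, -1, 0, 1), (0, 1, 0, -1)]

def piFlip : Fin 16 → Fin 16 := ![1, 0, 5, 4, 3, 2, 12, 13, 10, 11, 8, 9, 6, 7, 15, 14]

def matFlip : Q (Q ℤ) := ((1, 1, 1, 1), (0, 0, 1, -1), (0, 0, -1, 0), (0, -1, -1, 0))

def invFlip : Q (Q ℤ) := ((1, 1, 1, 1), (0, 0, 1, -1), (0, 0, -1, 0), (0, -1, -1, 0))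

def shiftFlip : Fin 16 → Q ℤ :=
  ![(0, 0, 0, 0), (0, 0, 0, 0), (0, 0, 0, 0), (0, 0, 0, 0), (0, 0, 0, 0), (0, 0, 0, 0), (0, 0, 0, 0), (0, 0, 0, 0),
    (0, 0, 0, 0), (0, 0, 0, 0), (0, 0, 0, 0), (0, 0, 0, 0), (0, 0, 0, 0), (0, 0, 0, 0), (0, 1, 0, -1), (0, -1, 0, 1)]

def loops : Fin 4 → List (Fin 3) := ![[1, 2, 0, 1, 2, 0, 1, 0], [0, 1, 2, 1, 0, 1, 0, 2], [1, 2, 0, 1, 0, 2], [2, 2, 1, 0, 1, 0]]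

def tree : Fin 16 → List (Fin 3) := ![[], [0], [1], [2], [0, 0], [0, 1], [1, 1], [1, 2], [2, 1], [2, 2], [0, 0, 1], [0, 0, 2], [0, 1, 1], [0, 1, 2], [1, 1, 2], [0, 0, 1, 2]]

def dot {R : Type} [CommRing R] (r : Q ℤ) (x : Q R) : R :=
  (r.1 : R) * x.1 + (r.2.1 : R) * x.2.1 + (r.2.2.1 : R) * x.2.2.1 + (r.2.2.2 : R) * x.2.2.2

def mv {R : Type} [CommRing R] (M : Q (Q ℤ)) (x : Q R) : Q R :=
  (dot M.1 x, dot M.2.1 x, dot M.2.2.1 x, dot M.2.2.2 x)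

theorem mv_add {R : Type} [CommRing R] (M : Q (Q ℤ)) (x y : Q R) :
    mv M (x + y) = mv M x + mv M y := by
  ext <;> simp only [mv, dot, Prod.fst_add, Prod.snd_add] <;> ring

/-- Reduction mod `n`. -/
def qc (n : ℕ) (x : Q ℤ) : Q (ZMod n) := (x.1, x.2.1, x.2.2.1, x.2.2.2)

theorem qc_add (n : ℕ) (x y : Q ℤ) : qc n (x + y) = qc n x + qc n y := by
  ext <;> simp [qc]

theorem qc_neg (n : ℕ) (x : Q ℤ) : qc n (-x) = -qc n x := by
  ext <;> simp [qc]

theorem qc_sub (n : ℕ) (x y : Q ℤ) : qc n (x - y) = qc n x - qc n y := by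
  ext <;> simp [qc]

theorem qc_zero (n : ℕ) : qc n 0 = 0 := by
  ext <;> simp [qc]

theorem qc_mv (n : ℕ) (M : Q (Q ℤ)) (x : Q ℤ) : qc n (mv M x) = mv M (qc n x) := by
  ext <;> simp [qc, mv, dot]

abbrev VV (n : ℕ) := Fin 16 × Q (ZMod n)

def step {n : ℕ} (p : VV n) (i : Fin 3) : VV n := (tgt p.1 i, p.2 + qc n (vol p.1 i))

theorem base_symm : ∀ v i, ∃ j, tgt (tgt v i) j = v ∧ vol (tgt v i) j = - vol v i := by
  decide +kernel

theorem base_irrefl : ∀ v i, tgt v i ≠ v := by decide +kernel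

theorem base_inj : ∀ v i j, tgt v i = tgt v j → i = j := by decide +kernel

def Lam (n : ℕ) : SimpleGraph (VV n) where
  Adj p q := ∃ i, q = step p i
  symm := ⟨by
    rintro p q ⟨i, rfl⟩
    obtain ⟨j, h1, h2⟩ := base_symm p.1 i
    refine ⟨j, ?_⟩
    simp [step, h1, h2, qc_neg]⟩
  loopless := ⟨by
    rintro p ⟨i, h⟩
    exact base_irrefl p.1 i (congrArg Prod.fst h).symm⟩

theorem step_inj {n : ℕ} (p : VV n) : Function.Injective (step p) := by
  intro i j h
  exact base_inj p.1 i j (congrArg Prod.fst h)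

theorem adj_step {n : ℕ} (p : VV n) (i : Fin 3) : (Lam n).Adj p (step p i) := ⟨i, rfl⟩

/-! ### Regularity -/

theorem card_nbr (n : ℕ) (p : VV n) : Nat.card ((Lam n).neighborSet p) = 3 := by
  have : (Lam n).neighborSet p = Set.range (step p) := by
    ext q
    constructor
    · rintro ⟨i, rfl⟩; exact ⟨i, rfl⟩
    · rintro ⟨i, rfl⟩; exact ⟨i, rfl⟩
  rw [this, Nat.card_range_of_injective (step_inj p)]
  simp

/-! ### Connectedness -/

def walkZ (v : Fin 16 × Q ℤ) (l : List (Fin 3)) : Fin 16 × Q ℤ :=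
  l.foldl (fun p i => (tgt p.1 i, p.2 + vol p.1 i)) v

theorem reach_walk (n : ℕ) (l : List (Fin 3)) : ∀ (p : Fin 16 × Q ℤ) (h : Q (ZMod n)),
    (Lam n).Reachable (p.1, h + qc n p.2) ((walkZ p l).1, h + qc n (walkZ p l).2) := by
  induction l with
  | nil => intro p h; exact SimpleGraph.Reachable.refl _
  | cons i l ih =>
    intro p h
    have h1 := adj_step (n := n) (p.1, h + qc n p.2) i
    have h2 := ih (tgt p.1 i, p.2 + vol p.1 i) h
    refine h1.reachable.trans ?_
    simpa [step, qc_add, add_assoc, walkZ] using h2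

theorem tree_ok : ∀ v, walkZ (0, 0) (tree v) = (v, 0) := by decide +kernel

theorem loops_ok : walkZ (0, 0) (loops 0) = (0, (1, 0, 0, 0)) ∧
    walkZ (0, 0) (loops 1) = (0, (0, 1, 0, 0)) ∧ walkZ (0, 0) (loops 2) = (0, (0, 0, 1, 0)) ∧
    walkZ (0, 0) (loops 3) = (0, (0, 0, 0, 1)) := by decide +kernel

theorem reach_of_walk {n : ℕ} {l : List (Fin 3)} {v : Fin 16} {t : Q ℤ}
    (h : walkZ (0, 0) l = (v, t)) (x : Q (ZMod n)) :
    (Lam n).Reachable (0, x) (v, x + qc n t) := by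
  have := reach_walk n l (0, 0) x
  rw [h] at this
  simpa [qc_zero] using this

def goodShifts (n : ℕ) : AddSubmonoid (Q (ZMod n)) where
  carrier := {t | ∀ x, (Lam n).Reachable (0, x) (0, x + t)}
  zero_mem' := by intro x; simp
  add_mem' := by
    intro s t hs ht x
    rw [← add_assoc]
    exact (hs x).trans (ht _)

theorem goodShifts_all (n : ℕ) [NeZero n] (t : Q (ZMod n)) : t ∈ goodShifts n := by
  have h0 : qc n (1, 0, 0, 0) ∈ goodShifts n := reach_of_walk loops_ok.1
  have h1 : qc n (0, 1, 0, 0) ∈ goodShifts n := reach_of_walk loops_ok.2.1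
  have h2 : qc n (0, 0, 1, 0) ∈ goodShifts n := reach_of_walk loops_ok.2.2.1
  have h3 : qc n (0, 0, 0, 1) ∈ goodShifts n := reach_of_walk loops_ok.2.2.2
  have key := add_mem (add_mem (nsmul_mem h0 t.1.val) (nsmul_mem h1 t.2.1.val))
    (add_mem (nsmul_mem h2 t.2.2.1.val) (nsmul_mem h3 t.2.2.2.val))
  convert key using 1
  ext <;> simp [qc]

theorem connected (n : ℕ) [NeZero n] : (Lam n).Connected := by
  rw [SimpleGraph.connected_iff_exists_forall_reachable]
  refine ⟨(0, 0), ?_⟩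
  rintro ⟨v, x⟩
  have h1 := goodShifts_all n x 0
  have h2 := reach_of_walk (tree_ok v) x
  rw [zero_add] at h1
  rw [qc_zero, add_zero] at h2
  exact h1.trans h2

/-! ### Automorphisms -/

theorem aut_mul {V : Type*} {Λ : SimpleGraph V} {g h : Equiv.Perm V} (hg : IsGraphAut Λ g)
    (hh : IsGraphAut Λ h) : IsGraphAut Λ (g * h) := by
  intro u v
  rw [Equiv.Perm.mul_apply, Equiv.Perm.mul_apply, hg, hh]

theorem aut_inv {V : Type*} {Λ : SimpleGraph V} {g : Equiv.Perm V} (hg : IsGraphAut Λ g) :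
    IsGraphAut Λ g⁻¹ := by
  intro u v
  rw [← hg]
  simp

theorem exists_aut (n : ℕ) [NeZero n] (π : Fin 16 → Fin 16) (M M' : Q (Q ℤ)) (s : Fin 16 → Q ℤ)
    (hπ : ∀ v w, π v = π w → v = w) (hM : ∀ x : Q (ZMod n), mv M' (mv M x) = x)
    (h1 : ∀ v i, ∃ j, π (tgt v i) = tgt (π v) j ∧
      mv M (vol v i) + s (tgt v i) = s v + vol (π v) j)
    (h2 : ∀ v j, ∃ i, π (tgt v i) = tgt (π v) j ∧
      mv M (vol v i) + s (tgt v i) = s v + vol (π v) j) :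
    ∃ g : Equiv.Perm (VV n), IsGraphAut (Lam n) g ∧
      ∀ p, g p = (π p.1, mv M p.2 + qc n (s p.1)) := by
  have hMi : ∀ x y : Q (ZMod n), mv M x = mv M y → x = y := fun x y h => by
    rw [← hM x, h, hM]
  let f : VV n → VV n := fun p => (π p.1, mv M p.2 + qc n (s p.1))
  have hf : Function.Injective f := by
    rintro ⟨v, x⟩ ⟨w, y⟩ h
    have ha : π v = π w := congrArg Prod.fst h
    have hb : mv M x + qc n (s v) = mv M y + qc n (s w) := congrArg Prod.snd h
    obtain rfl := hπ _ _ ha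
    rw [hMi x y (add_right_cancel hb)]
  refine ⟨Equiv.ofBijective f (Finite.injective_iff_bijective.mp hf), ?_, fun p => rfl⟩
  have key : ∀ (v : Fin 16) (x : Q (ZMod n)) i j, π (tgt v i) = tgt (π v) j →
      mv M (vol v i) + s (tgt v i) = s v + vol (π v) j →
      f (step (v, x) i) = step (f (v, x)) j := by
    intro v x i j ha hb
    have hb' := congrArg (qc n) hb
    rw [qc_add, qc_add, qc_mv] at hb'
    simp only [f, step]
    rw [ha, mv_add, add_assoc, hb', add_assoc]
  rintro ⟨v, x⟩ q
  change (∃ j, f q = step (f (v, x)) j) ↔ ∃ i, q = step (v, x) i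
  constructor
  · rintro ⟨j, hj⟩
    obtain ⟨i, ha, hb⟩ := h2 v j
    exact ⟨i, hf (by rw [hj, key v x i j ha hb])⟩
  · rintro ⟨i, rfl⟩
    obtain ⟨j, ha, hb⟩ := h1 v i
    exact ⟨j, key v x i j ha hb⟩

theorem mv_zero {R : Type} [CommRing R] (M : Q (Q ℤ)) : mv M (0 : Q R) = 0 := by
  ext <;> simp [mv, dot]

def org (n : ℕ) : VV n := (0, 0)

theorem step_org (n : ℕ) (i : Fin 3) : step (org n) i = (tgt 0 i, 0) := by
  have : vol 0 i = 0 := by revert i; decide +kernel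
  simp [step, org, this, qc_zero]

theorem exists_rot (n : ℕ) [NeZero n] : ∃ g : Equiv.Perm (VV n), IsGraphAut (Lam n) g ∧
    g (org n) = org n ∧ g (step (org n) 0) = step (org n) 1 ∧
    g (step (org n) 1) = step (org n) 2 ∧ g (step (org n) 2) = step (org n) 0 := by
  obtain ⟨g, hg, h⟩ := exists_aut n piRot matRot invRot shiftRot (by decide +kernel)
    (by intro x; ext <;> simp [mv, dot, matRot, invRot] <;> ring)
    (by decide +kernel) (by decide +kernel)
  refine ⟨g, hg, ?_, ?_, ?_, ?_⟩ <;> try simp only [step_org]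
  all_goals
    simp only [org, h, mv_zero, zero_add]
    refine Prod.ext rfl ?_
    exact qc_zero n

theorem exists_ref (n : ℕ) [NeZero n] : ∃ g : Equiv.Perm (VV n), IsGraphAut (Lam n) g ∧
    g (org n) = org n ∧ g (step (org n) 0) = step (org n) 0 ∧
    g (step (org n) 1) = step (org n) 2 ∧ g (step (org n) 2) = step (org n) 1 := by
  obtain ⟨g, hg, h⟩ := exists_aut n piRef matRef invRef shiftRef (by decide +kernel)
    (by intro x; ext <;> simp [mv, dot, matRef, invRef] <;> ring)
    (by decide +kernel) (by decide +kernel)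
  refine ⟨g, hg, ?_, ?_, ?_, ?_⟩ <;> try simp only [step_org]
  all_goals
    simp only [org, h, mv_zero, zero_add]
    refine Prod.ext rfl ?_
    exact qc_zero n

theorem exists_flip (n : ℕ) [NeZero n] : ∃ g : Equiv.Perm (VV n), IsGraphAut (Lam n) g ∧
    g (org n) = step (org n) 0 := by
  obtain ⟨g, hg, h⟩ := exists_aut n piFlip matFlip invFlip shiftFlip (by decide +kernel)
    (by intro x; ext <;> simp [mv, dot, matFlip, invFlip] <;> ring)
    (by decide +kernel) (by decide +kernel)
  refine ⟨g, hg, ?_⟩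
  simp only [step_org]
  simp only [org, h, mv_zero, zero_add]
  refine Prod.ext rfl ?_
  exact qc_zero n

theorem local_trans (n : ℕ) [NeZero n] (i j : Fin 3) (hij : i ≠ j) :
    ∃ g : Equiv.Perm (VV n), IsGraphAut (Lam n) g ∧ g (org n) = org n ∧
      g (step (org n) 0) = step (org n) i ∧ g (step (org n) 1) = step (org n) j := by
  obtain ⟨r, hr, r0, r1, r2, r3⟩ := exists_rot n
  obtain ⟨t, ht, t0, t1, t2, t3⟩ := exists_ref n
  fin_cases i <;> fin_cases j <;> simp at hij ⊢
  · exact ⟨1, fun _ _ => Iff.rfl, rfl, rfl, rfl⟩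
  · exact ⟨t, ht, t0, t1, t2⟩
  · exact ⟨r * t, aut_mul hr ht, by simp [t0, r0], by simp [t1, r1], by simp [t2, r3]⟩
  · exact ⟨r, hr, r0, r1, r2⟩
  · exact ⟨r * r, aut_mul hr hr, by simp [r0], by simp [r1, r2], by simp [r2, r3]⟩
  · exact ⟨r * (r * t), aut_mul hr (aut_mul hr ht), by simp [t0, r0], by simp [t1, r1, r2],
      by simp [t2, r3, r1]⟩

theorem org_nbr (n : ℕ) [NeZero n] (i : Fin 3) :
    ∃ g : Equiv.Perm (VV n), IsGraphAut (Lam n) g ∧ g (org n) = step (org n) i := by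
  obtain ⟨f, hf, f0⟩ := exists_flip n
  obtain ⟨g, hg, -, g1, -⟩ := local_trans n i (i + 1) (by revert i; decide)
  exact ⟨g * f, aut_mul hg hf, by simp [f0, g1]⟩

theorem vertex_trans (n : ℕ) [NeZero n] (p : VV n) :
    ∃ g : Equiv.Perm (VV n), IsGraphAut (Lam n) g ∧ g (org n) = p := by
  have hstep : ∀ u v : VV n, (Lam n).Adj u v →
      (∃ g : Equiv.Perm (VV n), IsGraphAut (Lam n) g ∧ g (org n) = u) →
      ∃ g : Equiv.Perm (VV n), IsGraphAut (Lam n) g ∧ g (org n) = v := by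
    rintro u v huv ⟨g, hg, rfl⟩
    have hadj : (Lam n).Adj (org n) (g⁻¹ v) := by
      rw [← hg]; simpa using huv
    obtain ⟨i, hi⟩ := hadj
    obtain ⟨k, hk, k0⟩ := org_nbr n i
    exact ⟨g * k, aut_mul hg hk, by rw [Equiv.Perm.mul_apply, k0, ← hi]; simp⟩
  obtain ⟨w⟩ := (connected n).preconnected (org n) p
  have : ∀ (u v : VV n) (w : (Lam n).Walk u v),
      (∃ g : Equiv.Perm (VV n), IsGraphAut (Lam n) g ∧ g (org n) = u) →
      ∃ g : Equiv.Perm (VV n), IsGraphAut (Lam n) g ∧ g (org n) = v := by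
    intro u v w
    induction w with
    | nil => exact id
    | cons h _ ih => exact fun hu => ih (hstep _ _ h hu)
  exact this _ _ w ⟨1, fun _ _ => Iff.rfl, rfl⟩

theorem arc_from_base (n : ℕ) [NeZero n] (u v w : VV n) (h1 : (Lam n).Adj u v)
    (h2 : (Lam n).Adj v w) (h : u ≠ w) :
    ∃ g : Equiv.Perm (VV n), IsGraphAut (Lam n) g ∧ g (step (org n) 0) = u ∧
      g (org n) = v ∧ g (step (org n) 1) = w := by
  obtain ⟨g, hg, rfl⟩ := vertex_trans n v
  have hu : (Lam n).Adj (org n) (g⁻¹ u) := by rw [← hg]; simpa using h1.symm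
  have hw : (Lam n).Adj (org n) (g⁻¹ w) := by rw [← hg]; simpa using h2
  obtain ⟨i, hi⟩ := hu
  obtain ⟨j, hj⟩ := hw
  have hij : i ≠ j := by
    rintro rfl
    exact h (g⁻¹.injective (hi.trans hj.symm))
  obtain ⟨k, hk, k0, k1, k2⟩ := local_trans n i j hij
  refine ⟨g * k, aut_mul hg hk, ?_, ?_, ?_⟩
  · rw [Equiv.Perm.mul_apply, k1, ← hi]; simp
  · rw [Equiv.Perm.mul_apply, k0]
  · rw [Equiv.Perm.mul_apply, k2, ← hj]; simp

theorem twoArc (n : ℕ) [NeZero n] : TwoArcTransitiveAut (Lam n) := by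
  intro u v w u' v' w' h1 h2 h h1' h2' h'
  obtain ⟨g, hg, rfl, rfl, rfl⟩ := arc_from_base n u v w h1 h2 h
  obtain ⟨k, hk, rfl, rfl, rfl⟩ := arc_from_base n u' v' w' h1' h2' h'
  exact ⟨k * g⁻¹, aut_mul hk (aut_inv hg), by simp, by simp, by simp⟩

/-! ### Eigenvectors -/

/-- Remove pairs of equal entries. -/
def cancel : List (Q ℤ) → List (Q ℤ)
  | [] => []
  | x :: l => if x ∈ cancel l then (cancel l).erase x else x :: cancel l

theorem sum_cancel (f : Q ℤ → ZMod 2) (l : List (Q ℤ)) :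
    ((cancel l).map f).sum = (l.map f).sum := by
  induction l with
  | nil => rfl
  | cons x l ih =>
    rw [cancel]
    split_ifs with hx
    · have := ((List.perm_cons_erase hx).map f).sum_eq
      rw [List.map_cons, List.sum_cons, ih] at this
      rw [List.map_cons, List.sum_cons, this, ← add_assoc, CharTwo.add_self_eq_zero, zero_add]
    · rw [List.map_cons, List.sum_cons, List.map_cons, List.sum_cons, ih]

def ell (v : Fin 16) : List (Q ℤ) :=
  supp v ++ ((supp (tgt v 0)).map (fun t => t - vol v 0) ++
    ((supp (tgt v 1)).map (fun t => t - vol v 1) ++ (supp (tgt v 2)).map (fun t => t - vol v 2)))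

theorem ell_cancel : ∀ v, cancel (ell v) = [] := by decide +kernel

/-- The basic eigenvector. -/
def xvec (n : ℕ) (p : VV n) : ZMod 2 :=
  ((supp p.1).map fun t => if p.2 = qc n t then (1 : ZMod 2) else 0).sum

theorem xvec_step (n : ℕ) (v : Fin 16) (x : Q (ZMod n)) (i : Fin 3) :
    xvec n (step (v, x) i) =
      (((supp (tgt v i)).map (fun t => t - vol v i)).map
        fun t => if x = qc n t then (1 : ZMod 2) else 0).sum := by
  simp only [xvec, step, List.map_map, Function.comp_def, qc_sub, eq_sub_iff_add_eq]
  congr!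

theorem xvec_eig (n : ℕ) (p : VV n) : ∑ i, xvec n (step p i) = xvec n p := by
  obtain ⟨v, x⟩ := p
  have h := sum_cancel (fun t => if x = qc n t then (1 : ZMod 2) else 0) (ell v)
  rw [ell_cancel, ell] at h
  simp only [List.map_append, List.sum_append, ← xvec_step, List.map_nil, List.sum_nil] at h
  rw [Fin.sum_univ_three]
  change 0 = xvec n (v, x) + _ at h
  rw [← add_assoc] at h
  generalize xvec n (step (v, x) 0) = a at *
  generalize xvec n (step (v, x) 1) = b at *
  generalize xvec n (step (v, x) 2) = c at *
  generalize xvec n (v, x) = d at *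
  revert a b c d
  decide

/-- Translates of the basic eigenvector. -/
def xtr (n : ℕ) (r : Q (ZMod n)) (p : VV n) : ZMod 2 := xvec n (p.1, p.2 - r)

theorem xtr_eig (n : ℕ) (r : Q (ZMod n)) (p : VV n) : ∑ i, xtr n r (step p i) = xtr n r p := by
  rw [xtr, ← xvec_eig]
  refine Finset.sum_congr rfl fun i _ => ?_
  simp only [xtr, step]
  congr 2
  abel

theorem sum_adj (n : ℕ) [NeZero n] (p : VV n) (f : VV n → ZMod 2)
    [∀ q, Decidable ((Lam n).Adj p q)] :
    ∑ q, (if (Lam n).Adj p q then f q else 0) = ∑ i, f (step p i) := by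
  rw [← Finset.sum_filter]
  have : Finset.univ.filter (fun q => (Lam n).Adj p q) = Finset.univ.image (step p) := by
    ext q
    simp only [Finset.mem_filter, Finset.mem_univ, true_and, Finset.mem_image]
    constructor
    · rintro ⟨i, rfl⟩; exact ⟨i, rfl⟩
    · rintro ⟨i, rfl⟩; exact ⟨i, rfl⟩
  rw [this, Finset.sum_image (fun a _ b _ h => step_inj p h)]

theorem mem_eigOne {V : Type*} [Fintype V] (Λ : SimpleGraph V) (x : V → ZMod 2)
    [∀ p q, Decidable (Λ.Adj p q)]
    (h : ∀ v, ∑ u, (if Λ.Adj v u then x u else 0) = x v) : x ∈ eigOne Λ := by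
  classical
  rw [eigOne, LinearMap.mem_ker, LinearMap.sub_apply, sub_eq_zero]
  ext v
  rw [Matrix.toLin'_apply, LinearMap.id_apply, ← h v]
  simp only [Matrix.mulVec, dotProduct, SimpleGraph.adjMatrix_apply, ite_mul, one_mul, zero_mul]

/-- Index set of the translates. -/
abbrev Idx (k : ℕ) := Fin k × Fin k × ZMod (2 * k) × ZMod (2 * k)

def sh {k : ℕ} (r : Idx k) : Q (ZMod (2 * k)) :=
  (((2 * r.1.val : ℕ) : ZMod (2 * k)), ((2 * r.2.1.val : ℕ) : ZMod (2 * k)), r.2.2.1, r.2.2.2)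

theorem sh_inj {k : ℕ} : Function.Injective (sh (k := k)) := by
  rintro ⟨a, b, c, d⟩ ⟨a', b', c', d'⟩ h
  simp only [sh, Prod.mk.injEq] at h
  obtain ⟨h1, h2, h3, h4⟩ := h
  have e : ∀ a a' : Fin k, ((2 * a.val : ℕ) : ZMod (2 * k)) = ((2 * a'.val : ℕ) : ZMod (2 * k)) →
      a = a' := by
    intro a a' h
    rw [ZMod.natCast_eq_natCast_iff] at h
    have := Nat.ModEq.eq_of_lt_of_lt h (by have := a.2; omega) (by have := a'.2; omega)
    ext; omega
  rw [e _ _ h1, e _ _ h2, h3, h4]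

/-- Parity on `ZMod (2 * k)`. -/
def par (k : ℕ) : ZMod (2 * k) →+* ZMod 2 := ZMod.castHom (Dvd.intro k rfl) (ZMod 2)

theorem par_even (k a : ℕ) : par k ((2 * a : ℕ) : ZMod (2 * k)) = 0 := by
  rw [map_natCast]
  push_cast
  rw [show (2 : ZMod 2) = 0 from rfl, zero_mul]

theorem xtr_delta {k : ℕ} (r r' : Idx k) :
    xtr (2 * k) (sh r) (0, sh r') = if r = r' then 1 else 0 := by
  have p1 : par k (sh r' - sh r).1 = 0 := by
    rw [Prod.fst_sub, map_sub]; simp only [sh, par_even, sub_zero]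
  have p2 : par k (sh r' - sh r).2.1 = 0 := by
    rw [Prod.snd_sub, Prod.fst_sub, map_sub]; simp only [sh, par_even, sub_zero]
  have n1 : sh r' - sh r ≠ qc (2 * k) (1, 0, 0, 0) := by
    intro h; rw [h] at p1; simp [qc] at p1
  have n2 : sh r' - sh r ≠ qc (2 * k) (0, 1, 0, 0) := by
    intro h; rw [h] at p2; simp [qc] at p2
  have n3 : sh r' - sh r ≠ qc (2 * k) (-1, 1, 0, 0) := by
    intro h; rw [h] at p2; simp [qc] at p2
  have hs : supp 0 = [(0, 0, 0, 0), (1, 0, 0, 0), (0, 1, 0, 0), (-1, 1, 0, 0)] := rfl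
  have hz : qc (2 * k) (0, 0, 0, 0) = 0 := qc_zero _
  simp only [xtr, xvec, hs, List.map_cons, List.map_nil, List.sum_cons, List.sum_nil, if_neg n1,
    if_neg n2, if_neg n3, hz, add_zero, sub_eq_zero, sh_inj.eq_iff, eq_comm]

end MK

open MK in
theorem statement3 (M : ℕ) :
    ∃ (m : ℕ) (Λ : SimpleGraph (Fin m)),
      M ≤ m ∧ Λ.Connected ∧ (∀ v : Fin m, Nat.card (Λ.neighborSet v) = 3) ∧
      TwoArcTransitiveAut Λ ∧ m ≤ 72 * Module.finrank (ZMod 2) (eigOne Λ) := by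
  classical
  let k : ℕ := M + 1
  have : NeZero (2 * k) := ⟨by omega⟩
  let m := Fintype.card (VV (2 * k))
  let e : Fin m ≃ VV (2 * k) := (Fintype.equivFin (VV (2 * k))).symm
  let Λ : SimpleGraph (Fin m) := (Lam (2 * k)).comap e
  let φ : Λ ≃g Lam (2 * k) := SimpleGraph.Iso.comap e _
  have hadj : ∀ a b, Λ.Adj a b ↔ (Lam (2 * k)).Adj (e a) (e b) := fun a b => Iff.rfl
  have hm : m = 256 * k ^ 4 := by
    simp only [m, VV, Q, Fintype.card_prod, ZMod.card, Fintype.card_fin]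
    ring
  have hI : Fintype.card (Idx k) = 4 * k ^ 4 := by
    simp only [Idx, Fintype.card_prod, ZMod.card, Fintype.card_fin]
    ring
  refine ⟨m, Λ, ?_, ?_, ?_, ?_, ?_⟩
  · have : k ≤ k ^ 4 := Nat.le_self_pow (by norm_num) k
    omega
  · exact φ.connected_iff.mpr (connected _)
  · intro v
    rw [← card_nbr (2 * k) (e v)]
    exact Nat.card_congr (φ.mapNeighborSet v)
  · intro u v w u' v' w' h1 h2 h h1' h2' h'
    obtain ⟨g, hg, a, b, c⟩ := twoArc (2 * k) (e u) (e v) (e w) (e u') (e v') (e w') h1 h2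
      (e.injective.ne h) h1' h2' (e.injective.ne h')
    refine ⟨(e.trans g).trans e.symm, ?_, ?_, ?_, ?_⟩
    · intro x y
      rw [hadj, hadj, ← hg (e x) (e y)]
      simp
    · simp [a]
    · simp [b]
    · simp [c]
  · have hmem : ∀ r : Idx k, (fun a => xtr (2 * k) (sh r) (e a)) ∈ eigOne Λ := by
      intro r
      apply mem_eigOne
      intro v
      rw [← xtr_eig, ← sum_adj, ← e.sum_comp]
      congr!
    let y : Idx k → eigOne Λ := fun r => ⟨_, hmem r⟩
    have hy : LinearIndependent (ZMod 2) y := by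
      rw [Fintype.linearIndependent_iff]
      intro c hc r'
      have h1 := congrFun (congrArg Subtype.val hc) (e.symm (0, sh r'))
      simpa [y, Finset.sum_apply, xtr_delta] using h1
    have := hy.fintype_card_le_finrank
    omega
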